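/- arXiv:math/0703094 — 2 statements merged into one kernel-verified Lean document; each statement's English description precedes it below -/
import Mathlib

section
/- Let g be a metric field on U and D its Levi-Civita covariant derivative. Then D is compatible with g: for all smooth vector fields a, b, c on U, a·∂(b·_g c) = (D_a b)·_g c + b·_g (D_a c) pointwise on U (the Ricci-type theorem for the Levi-Civita structure). -/
open scoped RealInnerProductSpace

noncomputable section

/-- The model space `ℝⁿ` with its standard inner product. -/
abbrev E (n : ℕ) := EuclideanSpace ℝ (Fin n)

/-- The directional ordinary derivative `a·∂X` of a vector field. -/
def dD {n : ℕ} (a X : E n → E n) (p : E n) : E n := fderiv ℝ X p (a p)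

/-- The plus covariant derivative `∇_a⁺X = a·∂X + γ_a(X)` associated to a connection field. -/
def covP {n : ℕ} (γ : E n → E n →L[ℝ] E n →L[ℝ] E n) (a X : E n → E n) (p : E n) : E n :=
  dD a X p + γ p (a p) (X p)

/-- The minus covariant derivative `∇_a⁻X = a·∂X − γ_a†(X)` associated to a connection field. -/
def covM {n : ℕ} (γ : E n → E n →L[ℝ] E n →L[ℝ] E n) (a X : E n → E n) (p : E n) : E n :=
  dD a X p - ContinuousLinearMap.adjoint (γ p (a p)) (X p)

/-- The Lie bracket `[a,b] = a·∂b − b·∂a` of vector fields. -/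
def lie {n : ℕ} (a b : E n → E n) (p : E n) : E n := dD a b p - dD b a p

/-- The vector `w_p(u,v)` with `⟨w_p(u,v), z⟩ = ½⟨u, Dg(p)(v)(z) − Dg(p)(z)(v)⟩` for all `z`. -/
def wmap {n : ℕ} (g : E n → E n →L[ℝ] E n) (p u v : E n) : E n :=
  (InnerProductSpace.toDual ℝ (E n)).symm
    ((1 / 2 : ℝ) • ((innerSL ℝ u).comp (fderiv ℝ g p v)
      - (innerSL ℝ u).comp ((fderiv ℝ g p).flip v)))

/-- The Levi-Civita connection field of the metric field `g`:
`λ_p(u,v) = ½ g(p)⁻¹(Dg(p)(u)(v)) + g(p)⁻¹(w_p(u,v))`. -/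
def lcc {n : ℕ} (g : E n → E n →L[ℝ] E n) (p u v : E n) : E n :=
  Ring.inverse (g p) ((1 / 2 : ℝ) • fderiv ℝ g p u v + wmap g p u v)

/-- The Levi-Civita covariant derivative `D_a b = a·∂b + λ(a,b)`. -/
def lcD {n : ℕ} (g : E n → E n →L[ℝ] E n) (a b : E n → E n) (p : E n) : E n :=
  dD a b p + lcc g p (a p) (b p)

/-- The derivative of a locally self-adjoint field of operators is self-adjoint. -/
theorem inner_fderiv_apply_comm {n : ℕ} {g : E n → E n →L[ℝ] E n} {p : E n}
    (hg : DifferentiableAt ℝ g p)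
    (hsa : ∀ᶠ q in nhds p, ContinuousLinearMap.adjoint (g q) = g q) (u v w : E n) :
    ⟪fderiv ℝ g p u v, w⟫ = ⟪v, fderiv ℝ g p u w⟫ := by
  have heq : (fun q => ⟪g q v, w⟫) =ᶠ[nhds p] fun q => ⟪v, g q w⟫ := by
    filter_upwards [hsa] with q hq
    rw [← ContinuousLinearMap.adjoint_inner_right, hq]
  have h := congrArg (fun L : E n →L[ℝ] ℝ => L u) heq.fderiv_eq
  have hv (x : E n) : HasFDerivAt (fun q => g q x) ((fderiv ℝ g p).flip x) p := by
    simpa using hg.hasFDerivAt.clm_apply (hasFDerivAt_const x p)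
  simpa [fderiv_inner_apply ℝ (hv v).differentiableAt (differentiableAt_const w),
    fderiv_inner_apply ℝ (differentiableAt_const v) (hv w).differentiableAt,
    (hv v).fderiv, (hv w).fderiv] using h

theorem inner_wmap {n : ℕ} (g : E n → E n →L[ℝ] E n) (p u v z : E n) :
    ⟪wmap g p u v, z⟫ = 1 / 2 * (⟪u, fderiv ℝ g p v z⟫ - ⟪u, fderiv ℝ g p z v⟫) := by
  rw [wmap, InnerProductSpace.toDual_symm_apply]
  simp

theorem apply_lcc {n : ℕ} {g : E n → E n →L[ℝ] E n} {p : E n} (hu : IsUnit (g p)) (u v : E n) :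
    g p (lcc g p u v) = (1 / 2 : ℝ) • fderiv ℝ g p u v + wmap g p u v := by
  rw [lcc, ← mul_apply_eq_comp, Ring.mul_inverse_cancel _ hu,
    one_apply_eq_self]

/-- The Levi-Civita covariant derivative is compatible with `g`:
`a·∂(b·_g c) = (D_a b)·_g c + b·_g (D_a c)` (Ricci-type theorem). -/
theorem stmt_11 {n : ℕ} (hn : 1 ≤ n) (U : Set (E n)) (hU : IsOpen U)
    (g : E n → E n →L[ℝ] E n) (hg : ContDiffOn ℝ (⊤ : ℕ∞) g U)
    (hgsa : ∀ p ∈ U, ContinuousLinearMap.adjoint (g p) = g p)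
    (hgu : ∀ p ∈ U, IsUnit (g p)) :
    ∀ a b c : E n → E n, ContDiffOn ℝ (⊤ : ℕ∞) a U → ContDiffOn ℝ (⊤ : ℕ∞) b U → ContDiffOn ℝ (⊤ : ℕ∞) c U →
      ∀ p ∈ U,
        fderiv ℝ (fun q => ⟪g q (b q), c q⟫) p (a p)
          = ⟪g p (lcD g a b p), c p⟫ + ⟪g p (b p), lcD g a c p⟫ := by
  intro a b c _ hb hc p hp
  have hU' : U ∈ nhds p := hU.mem_nhds hp
  have hgp : DifferentiableAt ℝ g p := (hg.contDiffAt hU').differentiableAt (by simp)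
  have hbp : DifferentiableAt ℝ b p := (hb.contDiffAt hU').differentiableAt (by simp)
  have hcp : DifferentiableAt ℝ c p := (hc.contDiffAt hU').differentiableAt (by simp)
  have hsymm := inner_fderiv_apply_comm hgp (Filter.eventually_of_mem hU' hgsa) (a p) (b p) (c p)
  have hgb := hgp.hasFDerivAt.clm_apply hbp.hasFDerivAt
  have hswap (x y : E n) : ⟪x, g p y⟫ = ⟪g p x, y⟫ := by
    rw [← ContinuousLinearMap.adjoint_inner_right, hgsa p hp]
  rw [fderiv_inner_apply ℝ hgb.differentiableAt hcp, hgb.fderiv, ← hswap (b p), ← hswap (b p)]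
  simp only [lcD, dD, map_add, apply_lcc (hgu p hp), inner_add_left, inner_add_right,
    real_inner_smul_left, real_inner_smul_right, inner_wmap,
    real_inner_comm (wmap g p (a p) (c p)) (b p), add_apply,
    ContinuousLinearMap.comp_apply, ContinuousLinearMap.flip_apply]
  linarith
end
end

section
/- (Theorem 2.) Let η ∈ End(E) be self-adjoint with η² = id, let h : U → End(E) be smooth with every h(p) invertible, and let g := h†∘η∘h pointwise (so g is a metric field and h a gauge metric field for g); write h⁻¹, h†, h* := (h†)⁻¹ for the pointwise inverse, adjoint and inverse adjoint of h. Let γ be a connection field on U whose associated pair (∇⁺, ∇⁻) is g-compatible, i.e., ∇_a⁻(g(b)) = g(∇_a⁺b) for all smooth vector fields a, b. Define ∇'_a⁺X := h(∇_a⁺(h⁻¹(X))) and ∇'_a⁻X := h*(∇_a⁻(h†(X))). Then: (i) there is a connection field δ on U with ∇'_a⁺X = a·∂X + δ_a(X) and ∇'_a⁻X = a·∂X − δ_a†(X); (ii) the pair (∇'⁺, ∇'⁻) is η-compatible: ∇'_a⁻(η(b)) = η(∇'_a⁺b) for all smooth vector fields a, b, where η(b) := p ↦ η(b(p)); (iii)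 h(∇_a⁺X) = ∇'_a⁺(h(X)) and h*(∇_a⁻X) = ∇'_a⁻(h*(X)) for all smooth a, X; and (iv) (∇'⁺, ∇'⁻) is the unique η-compatible pair associated to a connection field satisfying the intertwining relations (iii). -/
open scoped RealInnerProductSpace

noncomputable section

/-- The gauge (deformed) plus covariant derivative `∇'_a⁺X = h(∇_a⁺(h⁻¹(X)))`. -/
def defP {n : ℕ} (h : E n → E n →L[ℝ] E n) (γ : E n → E n →L[ℝ] E n →L[ℝ] E n)
    (a X : E n → E n) (p : E n) : E n :=
  h p (covP γ a (fun q => Ring.inverse (h q) (X q)) p)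

/-- The gauge (deformed) minus covariant derivative `∇'_a⁻X = h*(∇_a⁻(h†(X)))`. -/
def defM {n : ℕ} (h : E n → E n →L[ℝ] E n) (γ : E n → E n →L[ℝ] E n →L[ℝ] E n)
    (a X : E n → E n) (p : E n) : E n :=
  Ring.inverse (ContinuousLinearMap.adjoint (h p))
    (covM γ a (fun q => ContinuousLinearMap.adjoint (h q) (X q)) p)

section Helpers

variable {n : ℕ}

open ContinuousLinearMap

theorem dD_congr {U : Set (E n)} (hU : IsOpen U) (a : E n → E n) {X Y : E n → E n}
    (hXY : ∀ q ∈ U, X q = Y q) {p : E n} (hp : p ∈ U) : dD a X p = dD a Y p := by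
  have hev : X =ᶠ[nhds p] Y := by
    filter_upwards [hU.mem_nhds hp] with q hq using hXY q hq
  simp only [dD, hev.fderiv_eq]

theorem covP_congr {U : Set (E n)} (hU : IsOpen U) (γ : E n → E n →L[ℝ] E n →L[ℝ] E n)
    (a : E n → E n) {X Y : E n → E n} (hXY : ∀ q ∈ U, X q = Y q) {p : E n} (hp : p ∈ U) :
    covP γ a X p = covP γ a Y p := by
  simp only [covP, dD_congr hU a hXY hp, hXY p hp]

theorem covM_congr {U : Set (E n)} (hU : IsOpen U) (γ : E n → E n →L[ℝ] E n →L[ℝ] E n)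
    (a : E n → E n) {X Y : E n → E n} (hXY : ∀ q ∈ U, X q = Y q) {p : E n} (hp : p ∈ U) :
    covM γ a X p = covM γ a Y p := by
  simp only [covM, dD_congr hU a hXY hp, hXY p hp]

/-- The Leibniz rule for an endomorphism field applied to a vector field. -/
theorem dD_clm_apply (a : E n → E n) {t : E n → E n →L[ℝ] E n} {X : E n → E n} {p : E n}
    (ht : DifferentiableAt ℝ t p) (hX : DifferentiableAt ℝ X p) :
    dD a (fun q => t q (X q)) p = fderiv ℝ t p (a p) (X p) + t p (dD a X p) := by
  simp only [dD]
  rw [fderiv_clm_apply ht hX]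
  simp [add_comm]

theorem inverse_apply_apply {t : E n →L[ℝ] E n} (ht : IsUnit t) (v : E n) :
    Ring.inverse t (t v) = v :=
  DFunLike.congr_fun (Ring.inverse_mul_cancel t ht) v

theorem apply_inverse_apply {t : E n →L[ℝ] E n} (ht : IsUnit t) (v : E n) :
    t (Ring.inverse t v) = v :=
  DFunLike.congr_fun (Ring.mul_inverse_cancel t ht) v

theorem isUnit_adjoint {t : E n →L[ℝ] E n} (ht : IsUnit t) : IsUnit (adjoint t) :=
  IsUnit.star ht

theorem adjoint_inverse (t : E n →L[ℝ] E n) :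
    adjoint (Ring.inverse t) = Ring.inverse (adjoint t) :=
  (Ring.inverse_star t).symm

theorem contDiffOn_inverse {U : Set (E n)} {t : E n → E n →L[ℝ] E n}
    (ht : ContDiffOn ℝ (⊤ : ℕ∞) t U) (htu : ∀ p ∈ U, IsUnit (t p)) :
    ContDiffOn ℝ (⊤ : ℕ∞) (fun p => Ring.inverse (t p)) U := by
  intro p hp
  obtain ⟨u, hu⟩ := htu p hp
  have hinv := contDiffAt_ringInverse ℝ (n := ((⊤ : ℕ∞) : WithTop ℕ∞)) u
  rw [hu] at hinv
  exact hinv.comp_contDiffWithinAt p (ht p hp)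

theorem contDiffOn_adjoint {U : Set (E n)} {t : E n → E n →L[ℝ] E n}
    (ht : ContDiffOn ℝ (⊤ : ℕ∞) t U) : ContDiffOn ℝ (⊤ : ℕ∞) (fun p => adjoint (t p)) U :=
  (starL' ℝ : (E n →L[ℝ] E n) ≃L[ℝ] (E n →L[ℝ] E n)).contDiff.comp_contDiffOn ht

theorem fderiv_adjoint_apply (t : E n → E n →L[ℝ] E n) (p v : E n) :
    fderiv ℝ (fun q => adjoint (t q)) p v = adjoint (fderiv ℝ t p v) :=
  DFunLike.congr_fun
    ((starL' ℝ : (E n →L[ℝ] E n) ≃L[ℝ] (E n →L[ℝ] E n)).comp_fderiv (f := t) (x := p)) v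

/-- The connection field of the deformed pair, `δ_a = (h ∘ γ_a - a·∂h) ∘ h⁻¹`. -/
def gaugeConnection (h : E n → E n →L[ℝ] E n) (γ : E n → E n →L[ℝ] E n →L[ℝ] E n) (p : E n) :
    E n →L[ℝ] E n →L[ℝ] E n :=
  ((compL ℝ (E n) (E n) (E n)).flip (Ring.inverse (h p))).comp
    ((compL ℝ (E n) (E n) (E n) (h p)).comp (γ p) - fderiv ℝ h p)

theorem gaugeConnection_apply (h : E n → E n →L[ℝ] E n)
    (γ : E n → E n →L[ℝ] E n →L[ℝ] E n) (p v : E n) :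
    gaugeConnection h γ p v = (h p * γ p v - fderiv ℝ h p v) * Ring.inverse (h p) := rfl

theorem contDiffOn_gaugeConnection {U : Set (E n)} (hU : IsOpen U)
    {h : E n → E n →L[ℝ] E n} (hh : ContDiffOn ℝ (⊤ : ℕ∞) h U) (hhu : ∀ p ∈ U, IsUnit (h p))
    {γ : E n → E n →L[ℝ] E n →L[ℝ] E n} (hγ : ContDiffOn ℝ (⊤ : ℕ∞) γ U) :
    ContDiffOn ℝ (⊤ : ℕ∞) (gaugeConnection h γ) U := by
  have hdh : ContDiffOn ℝ (⊤ : ℕ∞) (fderiv ℝ h) U := hh.fderiv_of_isOpen hU le_rfl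
  have hleft : ContDiffOn ℝ (⊤ : ℕ∞) (fun p => compL ℝ (E n) (E n) (E n) (h p)) U :=
    contDiffOn_const.clm_apply hh
  have hright : ContDiffOn ℝ (⊤ : ℕ∞)
      (fun p => (compL ℝ (E n) (E n) (E n)).flip (Ring.inverse (h p))) U :=
    contDiffOn_const.clm_apply (contDiffOn_inverse hh hhu)
  exact hright.clm_comp ((hleft.clm_comp hγ).sub hdh)

theorem defP_eq_covP_gaugeConnection {U : Set (E n)} (hU : IsOpen U)
    {h : E n → E n →L[ℝ] E n} (hh : ContDiffOn ℝ (⊤ : ℕ∞) h U) (hhu : ∀ p ∈ U, IsUnit (h p))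
    (γ : E n → E n →L[ℝ] E n →L[ℝ] E n) (a : E n → E n) {X : E n → E n}
    (hX : ContDiffOn ℝ (⊤ : ℕ∞) X U) {p : E n} (hp : p ∈ U) :
    defP h γ a X p = covP (gaugeConnection h γ) a X p := by
  have hkX := (contDiffOn_inverse hh hhu).clm_apply hX
  have hleib := dD_clm_apply a
    ((hh.contDiffAt (hU.mem_nhds hp)).differentiableAt (by simp))
    ((hkX.contDiffAt (hU.mem_nhds hp)).differentiableAt (by simp))
  rw [dD_congr hU a (fun q hq => apply_inverse_apply (hhu q hq) (X q)) hp] at hleib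
  simp only [defP, covP, gaugeConnection_apply, map_add, hleib, mul_apply_eq_comp, sub_apply]
  abel

theorem defM_eq_covM_gaugeConnection {U : Set (E n)} (hU : IsOpen U)
    {h : E n → E n →L[ℝ] E n} (hh : ContDiffOn ℝ (⊤ : ℕ∞) h U) (hhu : ∀ p ∈ U, IsUnit (h p))
    (γ : E n → E n →L[ℝ] E n →L[ℝ] E n) (a : E n → E n) {X : E n → E n}
    (hX : ContDiffOn ℝ (⊤ : ℕ∞) X U) {p : E n} (hp : p ∈ U) :
    defM h γ a X p = covM (gaugeConnection h γ) a X p := by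
  have hadj : adjoint (gaugeConnection h γ p (a p)) =
      Ring.inverse (adjoint (h p)) *
        (adjoint (γ p (a p)) * adjoint (h p) - adjoint (fderiv ℝ h p (a p))) := by
    rw [gaugeConnection_apply, ← adjoint_inverse]
    simp only [← star_eq_adjoint, star_mul, star_sub]
  have hleib := dD_clm_apply a
    (((contDiffOn_adjoint hh).contDiffAt (hU.mem_nhds hp)).differentiableAt (by simp))
    ((hX.contDiffAt (hU.mem_nhds hp)).differentiableAt (by simp))
  rw [fderiv_adjoint_apply] at hleib
  simp only [defM, covM, hleib, hadj, map_add, map_sub, mul_apply_eq_comp, sub_apply,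
    inverse_apply_apply (isUnit_adjoint (hhu p hp))]
  abel

end Helpers

/-- **Theorem 2.** For a gauge metric field `h` for `g = h†∘η∘h` and a
`g`-compatible pair `(∇⁺, ∇⁻)`, the deformed pair `(∇'⁺, ∇'⁻)` is (i) the pair of covariant
derivatives of a connection field `δ`, (ii) `η`-compatible, (iii) intertwined with
`(∇⁺, ∇⁻)` by `h` and `h*`, and (iv) the unique such η-compatible pair. -/
theorem stmt_15 {n : ℕ} (hn : 1 ≤ n) (U : Set (E n)) (hU : IsOpen U)
    (η : E n →L[ℝ] E n) (hηsa : ContinuousLinearMap.adjoint η = η)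
    (hη2 : η.comp η = ContinuousLinearMap.id ℝ (E n))
    (h : E n → E n →L[ℝ] E n) (hh : ContDiffOn ℝ (⊤ : ℕ∞) h U) (hhu : ∀ p ∈ U, IsUnit (h p))
    (g : E n → E n →L[ℝ] E n)
    (hgdef : g = fun p => (ContinuousLinearMap.adjoint (h p)).comp (η.comp (h p)))
    (γ : E n → E n →L[ℝ] E n →L[ℝ] E n) (hγ : ContDiffOn ℝ (⊤ : ℕ∞) γ U)
    (hcompat : ∀ a b : E n → E n, ContDiffOn ℝ (⊤ : ℕ∞) a U → ContDiffOn ℝ (⊤ : ℕ∞) b U →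
      ∀ p ∈ U, covM γ a (fun q => g q (b q)) p = g p (covP γ a b p)) :
    -- (i) the deformed pair is a well-defined pair of covariant derivatives
    (∃ δ : E n → E n →L[ℝ] E n →L[ℝ] E n, ContDiffOn ℝ (⊤ : ℕ∞) δ U ∧
      ∀ a X : E n → E n, ContDiffOn ℝ (⊤ : ℕ∞) a U → ContDiffOn ℝ (⊤ : ℕ∞) X U →
        ∀ p ∈ U,
          defP h γ a X p = dD a X p + δ p (a p) (X p) ∧
          defM h γ a X p = dD a X p - ContinuousLinearMap.adjoint (δ p (a p)) (X p)) ∧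
    -- (ii) the deformed pair is η-compatible
    (∀ a b : E n → E n, ContDiffOn ℝ (⊤ : ℕ∞) a U → ContDiffOn ℝ (⊤ : ℕ∞) b U →
      ∀ p ∈ U, defM h γ a (fun q => η (b q)) p = η (defP h γ a b p)) ∧
    -- (iii) the intertwining relations
    (∀ a X : E n → E n, ContDiffOn ℝ (⊤ : ℕ∞) a U → ContDiffOn ℝ (⊤ : ℕ∞) X U →
      ∀ p ∈ U,
        h p (covP γ a X p) = defP h γ a (fun q => h q (X q)) p ∧
        Ring.inverse (ContinuousLinearMap.adjoint (h p)) (covM γ a X p)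
          = defM h γ a (fun q => Ring.inverse (ContinuousLinearMap.adjoint (h q)) (X q)) p) ∧
    -- (iv) uniqueness
    (∀ δ' : E n → E n →L[ℝ] E n →L[ℝ] E n, ContDiffOn ℝ (⊤ : ℕ∞) δ' U →
      (∀ a b : E n → E n, ContDiffOn ℝ (⊤ : ℕ∞) a U → ContDiffOn ℝ (⊤ : ℕ∞) b U →
        ∀ p ∈ U, covM δ' a (fun q => η (b q)) p = η (covP δ' a b p)) →
      (∀ a X : E n → E n, ContDiffOn ℝ (⊤ : ℕ∞) a U → ContDiffOn ℝ (⊤ : ℕ∞) X U →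
        ∀ p ∈ U,
          h p (covP γ a X p) = covP δ' a (fun q => h q (X q)) p ∧
          Ring.inverse (ContinuousLinearMap.adjoint (h p)) (covM γ a X p)
            = covM δ' a (fun q => Ring.inverse (ContinuousLinearMap.adjoint (h q)) (X q)) p) →
      ∀ a X : E n → E n, ContDiffOn ℝ (⊤ : ℕ∞) a U → ContDiffOn ℝ (⊤ : ℕ∞) X U →
        ∀ p ∈ U, covP δ' a X p = defP h γ a X p ∧ covM δ' a X p = defM h γ a X p) := by
  have hk {X : E n → E n} (hX : ContDiffOn ℝ (⊤ : ℕ∞) X U) :=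
    (contDiffOn_inverse hh hhu).clm_apply hX
  have hadj {X : E n → E n} (hX : ContDiffOn ℝ (⊤ : ℕ∞) X U) :=
    (contDiffOn_adjoint hh).clm_apply hX
  refine ⟨⟨gaugeConnection h γ, contDiffOn_gaugeConnection hU hh hhu hγ,
    fun a X _ hX p hp => ⟨defP_eq_covP_gaugeConnection hU hh hhu γ a hX hp,
      defM_eq_covM_gaugeConnection hU hh hhu γ a hX hp⟩⟩, ?_, ?_, ?_⟩
  · intro a b ha hb p hp
    have hgk : ∀ q ∈ U, ContinuousLinearMap.adjoint (h q) (η (b q)) =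
        g q (Ring.inverse (h q) (b q)) := by
      intro q hq
      simp [hgdef, apply_inverse_apply (hhu q hq)]
    rw [defM, covM_congr hU γ a hgk hp, hcompat a _ ha (hk hb) p hp, hgdef]
    exact inverse_apply_apply (isUnit_adjoint (hhu p hp)) _
  · intro a X _ _ p hp
    exact ⟨congrArg (h p) (covP_congr hU γ a
        (fun q hq => (inverse_apply_apply (hhu q hq) (X q)).symm) hp),
      congrArg (⇑(Ring.inverse (ContinuousLinearMap.adjoint (h p)))) (covM_congr hU γ a
        (fun q hq => (apply_inverse_apply (isUnit_adjoint (hhu q hq)) (X q)).symm) hp)⟩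
  · intro δ' _ _ hint a X ha hX p hp
    constructor
    · rw [defP, (hint a _ ha (hk hX) p hp).1]
      exact covP_congr hU δ' a (fun q hq => (apply_inverse_apply (hhu q hq) (X q)).symm) hp
    · rw [defM, (hint a _ ha (hadj hX) p hp).2]
      exact covM_congr hU δ' a
        (fun q hq => (inverse_apply_apply (isUnit_adjoint (hhu q hq)) (X q)).symm) hp
end
end
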